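/- arXiv:2406.01709 — 4 statements merged into one kernel-verified Lean document; each statement's English description precedes it below -/
import Mathlib

section
/- Let α ∈ (0,2), β > 0 and Λ > 0 be constants, and set a = Γ(1+α/2)/Γ(1+α). Define φ : [0,1) → ℝ by φ(x) = β − (2Λ/(2−α))·( (2−α)·x²/(1−x) + 2a/(1−x)³ − 2a + (2a−1)·x²/(1−x²) ). Then φ is strictly decreasing on [0,1). -/
open Filter

/-- Rising factorial (Pochhammer symbol) `(q)_n = q (q+1) ⋯ (q+n-1)`. -/
noncomputable def risingFactorial (q : ℝ) (n : ℕ) : ℝ := ∏ i ∈ Finset.range n, (q + i)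

/-- Gauss hypergeometric function `F(a,b;c;x) = Σ (a)_n (b)_n / (c)_n · x^n / n!`. -/
noncomputable def hyperF (a b c x : ℝ) : ℝ :=
  ∑' n : ℕ, risingFactorial a n * risingFactorial b n / risingFactorial c n * x ^ n / n.factorial

/-- Wirtinger derivative `f_z = (f_x - i f_y)/2`. -/
noncomputable def wDz (f : ℂ → ℂ) (z : ℂ) : ℂ :=
  (fderiv ℝ f z 1 - Complex.I * fderiv ℝ f z Complex.I) / 2

/-- Wirtinger derivative `f_z̄ = (f_x + i f_y)/2`. -/
noncomputable def wDzbar (f : ℂ → ℂ) (z : ℂ) : ℂ :=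
  (fderiv ℝ f z 1 + Complex.I * fderiv ℝ f z Complex.I) / 2

/-- `Λ_f(z) = |f_z(z)| + |f_z̄(z)|`. -/
noncomputable def LambdaF (f : ℂ → ℂ) (z : ℂ) : ℝ := ‖wDz f z‖ + ‖wDzbar f z‖

/-- `λ_f(z) = ||f_z(z)| - |f_z̄(z)||`. -/
noncomputable def lambdaF (f : ℂ → ℂ) (z : ℂ) : ℝ := |‖wDz f z‖ - ‖wDzbar f z‖|

/-- `f` is an `α`-harmonic mapping on the unit disc with coefficient sequence `c`. -/
def IsAlphaHarmonic (α : ℝ) (f : ℂ → ℂ) (c : ℤ → ℂ) : Prop :=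
  Filter.limsup (fun k : ℤ => ‖c k‖ ^ (1 / (|k| : ℝ))) Filter.cofinite ≤ 1 ∧
  ∀ z ∈ Metric.ball (0 : ℂ) 1,
    f z = (∑' k : ℕ, c (k : ℤ) *
            (hyperF (-α/2) ((k : ℝ) - α/2) ((k : ℝ) + 1) (‖z‖^2) : ℂ) * z ^ k)
        + ∑' k : ℕ, c (-((k : ℤ) + 1)) *
            (hyperF (-α/2) (((k : ℝ) + 1) - α/2) (((k : ℝ) + 1) + 1) (‖z‖^2) : ℂ) *
            (starRingEnd ℂ z) ^ (k + 1)

/-- On `[0, 1]` the Gamma function satisfies `Γ(1 + 2s) ≤ (1 + s²) Γ(1 + s)`, by convexity. -/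
theorem Gamma_one_add_two_mul_le {s : ℝ} (hs0 : 0 ≤ s) (hs1 : s ≤ 1) :
    Real.Gamma (1 + 2 * s) ≤ (1 + s ^ 2) * Real.Gamma (1 + s) := by
  have hconv := Real.convexOn_Gamma.2 (x := 1 + s) (y := 1 + s + 1)
    (Set.mem_Ioi.2 (by linarith)) (Set.mem_Ioi.2 (by linarith))
    (sub_nonneg.2 hs1) hs0 (by ring)
  simp only [smul_eq_mul] at hconv
  rw [Real.Gamma_add_one (by linarith),
    show (1 - s) * (1 + s) + s * (1 + s + 1) = 1 + 2 * s by ring] at hconv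
  linarith

theorem half_le_Gamma_div_Gamma {α : ℝ} (hα : α ∈ Set.Ioo (0 : ℝ) 2) :
    1 / 2 ≤ Real.Gamma (1 + α / 2) / Real.Gamma (1 + α) := by
  obtain ⟨h0, h2⟩ := hα
  have hpos : 0 < Real.Gamma (1 + α / 2) := Real.Gamma_pos_of_pos (by linarith)
  have hle := Gamma_one_add_two_mul_le (s := α / 2) (by linarith) (by linarith)
  rw [mul_div_cancel₀ α two_ne_zero] at hle
  rw [le_div_iff₀ (Real.Gamma_pos_of_pos (by linarith))]
  have hsq : (α / 2) ^ 2 ≤ 1 := pow_le_one₀ (by linarith) (by linarith)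
  nlinarith [mul_le_mul_of_nonneg_right hsq hpos.le]

/-- The auxiliary function `φ` is strictly decreasing on `[0,1)` (part of Lemma 3.1). -/
theorem phi_strictAntiOn
    (α β Λ a : ℝ) (hα : α ∈ Set.Ioo (0 : ℝ) 2) (hβ : 0 < β) (hΛ : 0 < Λ)
    (ha : a = Real.Gamma (1 + α/2) / Real.Gamma (1 + α))
    (φ : ℝ → ℝ)
    (hφ : ∀ x, φ x = β - 2 * Λ / (2 - α) *
      ((2 - α) * x^2 / (1 - x) + 2 * a / (1 - x)^3 - 2 * a + (2 * a - 1) * x^2 / (1 - x^2))) :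
    StrictAntiOn φ (Set.Ico 0 1) := by
  have ha2 : 1 / 2 ≤ a := ha ▸ half_le_Gamma_div_Gamma hα
  intro x hx y hy hxy
  obtain ⟨hx0, hx1⟩ := hx
  obtain ⟨hy0, hy1⟩ := hy
  have hα2 : 0 < 2 - α := sub_pos.2 hα.2
  have hc : 0 < 2 * Λ / (2 - α) := by positivity
  have hy1' : 0 < 1 - y := sub_pos.2 hy1
  have hsq : x ^ 2 ≤ y ^ 2 := by gcongr
  have hy2 : 0 < 1 - y ^ 2 := by nlinarith
  have h1 : (2 - α) * x ^ 2 / (1 - x) ≤ (2 - α) * y ^ 2 / (1 - y) := by gcongr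
  have h2 : 2 * a / (1 - x) ^ 3 < 2 * a / (1 - y) ^ 3 := by gcongr
  have h3 : (2 * a - 1) * x ^ 2 / (1 - x ^ 2) ≤ (2 * a - 1) * y ^ 2 / (1 - y ^ 2) := by
    have h : 0 ≤ 2 * a - 1 := by linarith
    gcongr
  rw [hφ, hφ]
  gcongr β - _ * ?_
  linarith
end

section
/- Let α ∈ (0,2), β > 0 and Λ > 0 be constants, and set a = Γ(1+α/2)/Γ(1+α). Define φ : [0,1) → ℝ by φ(x) = β − (2Λ/(2−α))·( (2−α)·x²/(1−x) + 2a/(1−x)³ − 2a + (2a−1)·x²/(1−x²) ). Then there exists a unique x₀ ∈ (0,1) such that φ(x₀) = 0. -/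
open Filter

/-- The bound `1/4 ≤ Γ(1 + α/2) / Γ(1 + α)` on `(0, 2)`. -/
theorem quarter_le_Gamma_div_Gamma {α : ℝ} (h0 : 0 < α) (h2 : α < 2) :
    1 / 4 ≤ Real.Gamma (1 + α / 2) / Real.Gamma (1 + α) := by
  have g2 : Real.Gamma 2 = 1 := Real.Gamma_two
  have g3 : Real.Gamma 3 = 2 := by
    rw [show (3 : ℝ) = 2 + 1 by norm_num, Real.Gamma_add_one (by norm_num), g2, mul_one]
  have hnum : 1 / 2 ≤ Real.Gamma (1 + α / 2) := by
    have h := Real.Gamma_add_one (s := 1 + α / 2) (by positivity)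
    have hs : 2 ≤ 1 + α / 2 + 1 := by linarith
    have hb := Real.Gamma_strictMonoOn_Ici.monotoneOn Set.self_mem_Ici hs hs
    have hp : 0 < Real.Gamma (1 + α / 2) := Real.Gamma_pos_of_pos (by positivity)
    nlinarith
  have hpos : 0 < Real.Gamma (1 + α) := Real.Gamma_pos_of_pos (by positivity)
  have hden : Real.Gamma (1 + α) ≤ 2 := by
    have h := Real.convexOn_Gamma.2 (show (1 : ℝ) ∈ Set.Ioi 0 by norm_num)
      (show (3 : ℝ) ∈ Set.Ioi 0 by norm_num) (show 0 ≤ 1 - α / 2 by linarith)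
      (show 0 ≤ α / 2 by linarith) (by ring)
    simp only [smul_eq_mul, Real.Gamma_one, g3] at h
    rw [show (1 - α / 2) * 1 + α / 2 * 3 = 1 + α by ring] at h
    linarith
  rw [le_div_iff₀ hpos]
  linarith

/-- For `1/4 ≤ a` and `0 ≤ b`, the right-hand side is a nonnegative combination of functions
increasing on `[0, 1)`. -/
theorem profile_eq {a b x : ℝ} (h0 : 0 ≤ x) (h1 : x < 1) :
    b * x ^ 2 / (1 - x) + 2 * a / (1 - x) ^ 3 - 2 * a + (2 * a - 1) * x ^ 2 / (1 - x ^ 2) =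
      b * (x ^ 2 * (1 - x)⁻¹) + (2 * a - 1 / 2) * ((1 - x)⁻¹ ^ 3 + (1 - x ^ 2)⁻¹ - 2)
        + 1 / 2 * ((1 - x)⁻¹ * ((1 - x)⁻¹ ^ 2 - (1 + x)⁻¹)) := by
  have e1 : 1 - x ≠ 0 := by linarith
  have e2 : 1 + x ≠ 0 := by linarith
  rw [show 1 - x ^ 2 = (1 - x) * (1 + x) by ring]
  field_simp
  ring

theorem profile_strictMonoOn {a b : ℝ} (ha : 1 / 4 ≤ a) (hb : 0 ≤ b) :
    StrictMonoOn (fun x : ℝ => b * x ^ 2 / (1 - x) + 2 * a / (1 - x) ^ 3 - 2 * a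
      + (2 * a - 1) * x ^ 2 / (1 - x ^ 2)) (Set.Ico 0 1) := by
  rintro x ⟨hx0, hx1⟩ y ⟨hy0, hy1⟩ hxy
  simp only
  rw [profile_eq hx0 hx1, profile_eq hy0 hy1]
  have px : 0 < 1 - x := by linarith
  have py : 0 < 1 - y := by linarith
  have hu : (1 - x)⁻¹ < (1 - y)⁻¹ := by gcongr
  have hu1 : 1 ≤ (1 - x)⁻¹ := (one_le_inv₀ px).2 (by linarith)
  have hv : (1 + y)⁻¹ ≤ (1 + x)⁻¹ := by gcongr
  have hv1 : (1 + x)⁻¹ ≤ 1 := inv_le_one_of_one_le₀ (by linarith)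
  have hw : (1 - x ^ 2)⁻¹ ≤ (1 - y ^ 2)⁻¹ := by
    have : 0 < 1 - y ^ 2 := by nlinarith
    gcongr
  have hu2 : (1 - x)⁻¹ ^ 2 < (1 - y)⁻¹ ^ 2 := by gcongr
  have hlin : b * (x ^ 2 * (1 - x)⁻¹) ≤ b * (y ^ 2 * (1 - y)⁻¹) := by gcongr
  have hcub : (2 * a - 1 / 2) * ((1 - x)⁻¹ ^ 3 + (1 - x ^ 2)⁻¹ - 2) ≤
      (2 * a - 1 / 2) * ((1 - y)⁻¹ ^ 3 + (1 - y ^ 2)⁻¹ - 2) := by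
    have : 0 ≤ 2 * a - 1 / 2 := by linarith
    gcongr
  have hprod : (1 - x)⁻¹ * ((1 - x)⁻¹ ^ 2 - (1 + x)⁻¹) <
      (1 - y)⁻¹ * ((1 - y)⁻¹ ^ 2 - (1 + y)⁻¹) :=
    mul_lt_mul'' hu (by linarith) (by positivity) (by nlinarith)
  linarith

theorem inv_sub_one_le_profile {a b x : ℝ} (ha : 1 / 4 ≤ a) (hb : 0 ≤ b) (h0 : 0 ≤ x)
    (h1 : x < 1) :
    (1 - x)⁻¹ - 1 ≤ b * x ^ 2 / (1 - x) + 2 * a / (1 - x) ^ 3 - 2 * a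
      + (2 * a - 1) * x ^ 2 / (1 - x ^ 2) := by
  rw [profile_eq h0 h1]
  have px : 0 < 1 - x := by linarith
  have hu : 1 ≤ (1 - x)⁻¹ := (one_le_inv₀ px).2 (by linarith)
  have hv : (1 + x)⁻¹ ≤ 1 := inv_le_one_of_one_le₀ (by linarith)
  have hw : 1 ≤ (1 - x ^ 2)⁻¹ := (one_le_inv₀ (by nlinarith)).2 (by nlinarith)
  have hlin : 0 ≤ b * (x ^ 2 * (1 - x)⁻¹) := by positivity
  have hcub : 0 ≤ (2 * a - 1 / 2) * ((1 - x)⁻¹ ^ 3 + (1 - x ^ 2)⁻¹ - 2) := by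
    have := one_le_pow₀ hu (n := 3)
    exact mul_nonneg (by linarith) (by linarith)
  generalize (1 - x)⁻¹ = u at *
  generalize (1 + x)⁻¹ = v at *
  have hprod : 2 * (u - 1) ≤ u * (u ^ 2 - v) := by
    have h : 2 * (u - 1) ≤ u ^ 2 - v := by nlinarith
    nlinarith
  linarith

theorem profile_continuousOn {a b : ℝ} :
    ContinuousOn (fun x : ℝ => b * x ^ 2 / (1 - x) + 2 * a / (1 - x) ^ 3 - 2 * a
      + (2 * a - 1) * x ^ 2 / (1 - x ^ 2)) (Set.Ico 0 1) := by
  have h1 : ∀ x ∈ Set.Ico (0 : ℝ) 1, 1 - x ≠ 0 := fun x hx => by linarith [hx.2]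
  have h2 : ∀ x ∈ Set.Ico (0 : ℝ) 1, (1 - x) ^ 3 ≠ 0 := fun x hx => pow_ne_zero _ (h1 x hx)
  have h3 : ∀ x ∈ Set.Ico (0 : ℝ) 1, 1 - x ^ 2 ≠ 0 := fun x hx => by nlinarith [hx.1, hx.2]
  fun_prop (disch := assumption)

/-- The auxiliary function `φ` has a unique zero in `(0,1)` (part of Lemma 3.1). -/
theorem phi_unique_zero
    (α β Λ a : ℝ) (hα : α ∈ Set.Ioo (0 : ℝ) 2) (hβ : 0 < β) (hΛ : 0 < Λ)
    (ha : a = Real.Gamma (1 + α/2) / Real.Gamma (1 + α))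
    (φ : ℝ → ℝ)
    (hφ : ∀ x, φ x = β - 2 * Λ / (2 - α) *
      ((2 - α) * x^2 / (1 - x) + 2 * a / (1 - x)^3 - 2 * a + (2 * a - 1) * x^2 / (1 - x^2))) :
    ∃! x₀ : ℝ, x₀ ∈ Set.Ioo (0 : ℝ) 1 ∧ φ x₀ = 0 := by
  obtain ⟨h0, h2⟩ := hα
  have ha4 : 1 / 4 ≤ a := ha ▸ quarter_le_Gamma_div_Gamma h0 h2
  have hb : 0 < 2 - α := by linarith
  have hmono := profile_strictMonoOn ha4 hb.le
  have hcont := profile_continuousOn (a := a) (b := 2 - α)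
  have hlarge := fun x => inv_sub_one_le_profile (x := x) ha4 hb.le
  set g : ℝ → ℝ := fun x => (2 - α) * x ^ 2 / (1 - x) + 2 * a / (1 - x) ^ 3 - 2 * a
    + (2 * a - 1) * x ^ 2 / (1 - x ^ 2) with hg
  set K := β * (2 - α) / (2 * Λ) with hK
  have hKpos : 0 < K := by positivity
  have hzero : ∀ x, φ x = 0 ↔ g x = K := by
    intro x
    rw [hφ x, show β = 2 * Λ / (2 - α) * K by rw [hK]; field_simp, ← mul_sub, mul_eq_zero,
      or_iff_right (by positivity), sub_eq_zero, eq_comm]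
  have hg0 : g 0 = 0 := by simp [hg]
  set c := 1 - (K + 2)⁻¹ with hc
  have hinv : (K + 2)⁻¹ < 1 := inv_lt_one_of_one_lt₀ (by linarith)
  have hc0 : 0 ≤ c := by linarith
  have hc1 : c < 1 := by
    have : 0 < (K + 2)⁻¹ := by positivity
    linarith
  have hgc : K < g c := by
    have h := hlarge c hc0 hc1
    rw [show (1 - c)⁻¹ = K + 2 by rw [hc, sub_sub_cancel, inv_inv]] at h
    change _ ≤ g c at h
    linarith
  obtain ⟨x, ⟨hx0, hxc⟩, hx⟩ := intermediate_value_Icc hc0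
    (hcont.mono (Set.Icc_subset_Ico_right hc1)) ⟨hg0.trans_le hKpos.le, hgc.le⟩
  have hxpos : 0 < x := hx0.lt_of_ne (by rintro rfl; linarith)
  refine ⟨x, ⟨⟨hxpos, hxc.trans_lt hc1⟩, (hzero x).2 hx⟩, ?_⟩
  rintro y ⟨⟨hy0, hy1⟩, hy⟩
  exact hmono.injOn ⟨hy0.le, hy1⟩ ⟨hx0, hxc.trans_lt hc1⟩ (((hzero y).1 hy).trans hx.symm)
end

section
/- Let α ∈ (0,2) and let k ≥ 1 be an integer. Then the function t ↦ F(−α/2, k−α/2; k+1; t) is strictly decreasing on [0,1); in particular, F(−α/2, k−α/2; k+1; t) ≤ F(−α/2, k−α/2; k+1; 0) = 1 for all t ∈ [0,1). -/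
open Filter

theorem risingFactorial_pos {q : ℝ} (hq : 0 < q) (n : ℕ) : 0 < risingFactorial q n :=
  Finset.prod_pos fun i _ => by positivity

theorem risingFactorial_succ_neg {q : ℝ} (hq : q ∈ Set.Ioo (-1 : ℝ) 0) (n : ℕ) :
    risingFactorial q (n + 1) < 0 := by
  rw [risingFactorial, Finset.prod_range_succ']
  refine mul_neg_of_pos_of_neg (Finset.prod_pos fun i _ => ?_) (by simpa using hq.2)
  have h := hq.1
  have hi : (0 : ℝ) ≤ i := i.cast_nonneg
  push_cast
  linarith

theorem risingFactorial_le_risingFactorial {b c : ℝ} (hb : 0 ≤ b) (hbc : b ≤ c) (n : ℕ) :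
    risingFactorial b n ≤ risingFactorial c n :=
  Finset.prod_le_prod (fun i _ => by positivity) fun i _ => by gcongr

theorem abs_risingFactorial_le_factorial {q : ℝ} (hq : |q| ≤ 1) (n : ℕ) :
    |risingFactorial q n| ≤ n.factorial := by
  rw [risingFactorial, Finset.abs_prod, ← Finset.prod_range_add_one_eq_factorial, Nat.cast_prod]
  refine Finset.prod_le_prod (fun i _ => abs_nonneg _) fun i _ => ?_
  calc |q + i| ≤ |q| + |(i : ℝ)| := abs_add_le _ _
    _ ≤ ((i + 1 : ℕ) : ℝ) := by
      rw [Nat.abs_cast]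
      push_cast
      linarith

theorem summable_hyperF {a b c x : ℝ} (ha : |a| ≤ 1) (hb : 0 < b) (hbc : b ≤ c) (hx : |x| < 1) :
    Summable fun n : ℕ =>
      risingFactorial a n * risingFactorial b n / risingFactorial c n * x ^ n / n.factorial := by
  refine Summable.of_norm_bounded (summable_geometric_of_lt_one (abs_nonneg x) hx) fun n => ?_
  have hbn := risingFactorial_pos hb n
  have hcn := risingFactorial_pos (hb.trans_le hbc) n
  have hn : (0 : ℝ) < n.factorial := by positivity
  rw [Real.norm_eq_abs, abs_div, abs_mul, abs_div, abs_mul, abs_of_pos hbn, abs_of_pos hcn,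
    abs_of_pos hn, abs_pow, div_le_iff₀ hn, mul_comm (|x| ^ n)]
  gcongr
  rw [div_le_iff₀ hcn]
  exact mul_le_mul (abs_risingFactorial_le_factorial ha n)
    (risingFactorial_le_risingFactorial hb.le hbc n) hbn.le hn.le

theorem hyperF_zero (a b c : ℝ) : hyperF a b c 0 = 1 := by
  rw [hyperF, tsum_eq_single 0 fun n hn => by simp [hn]]
  simp [risingFactorial]

theorem strictAntiOn_hyperF {a b c : ℝ} (ha : a ∈ Set.Ioo (-1 : ℝ) 0) (hb : 0 < b) (hbc : b ≤ c) :
    StrictAntiOn (hyperF a b c) (Set.Ico 0 1) := by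
  intro x hx y hy hxy
  have ha' : |a| ≤ 1 := abs_le.2 ⟨ha.1.le, by linarith [ha.2]⟩
  have hlt (n : ℕ) :
      risingFactorial a (n + 1) * risingFactorial b (n + 1) / risingFactorial c (n + 1) *
          y ^ (n + 1) / (n + 1).factorial <
        risingFactorial a (n + 1) * risingFactorial b (n + 1) / risingFactorial c (n + 1) *
          x ^ (n + 1) / (n + 1).factorial := by
    refine div_lt_div_of_pos_right (mul_lt_mul_of_neg_left
      (pow_lt_pow_left₀ hxy hx.1 n.succ_ne_zero) ?_) (by positivity)
    exact div_neg_of_neg_of_pos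
      (mul_neg_of_neg_of_pos (risingFactorial_succ_neg ha n) (risingFactorial_pos hb _))
      (risingFactorial_pos (hb.trans_le hbc) _)
  refine Summable.tsum_lt_tsum (i := 1) (fun n => ?_) (hlt 0)
    (summable_hyperF ha' hb hbc (by rw [abs_of_nonneg hy.1]; exact hy.2))
    (summable_hyperF ha' hb hbc (by rw [abs_of_nonneg hx.1]; exact hx.2))
  cases n with
  | zero => simp
  | succ n => exact (hlt n).le

/-- `t ↦ F(-α/2, k-α/2; k+1; t)` is strictly decreasing on `[0,1)` and bounded by its
value `1` at `0`. -/
theorem hyperF_strictAntiOn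
    (α : ℝ) (hα : α ∈ Set.Ioo (0 : ℝ) 2) (k : ℕ) (hk : 1 ≤ k) :
    StrictAntiOn (fun t : ℝ => hyperF (-α/2) ((k : ℝ) - α/2) ((k : ℝ) + 1) t)
      (Set.Ico 0 1) ∧
    hyperF (-α/2) ((k : ℝ) - α/2) ((k : ℝ) + 1) 0 = 1 ∧
    ∀ t ∈ Set.Ico (0 : ℝ) 1,
      hyperF (-α/2) ((k : ℝ) - α/2) ((k : ℝ) + 1) t ≤
        hyperF (-α/2) ((k : ℝ) - α/2) ((k : ℝ) + 1) 0 := by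
  obtain ⟨h0, h2⟩ := hα
  have hk' : (1 : ℝ) ≤ k := by exact_mod_cast hk
  have h : StrictAntiOn (hyperF (-α/2) ((k : ℝ) - α/2) ((k : ℝ) + 1)) (Set.Ico 0 1) :=
    strictAntiOn_hyperF ⟨by linarith, by linarith⟩ (by linarith) (by linarith)
  exact ⟨h, hyperF_zero _ _ _, fun t ht => h.antitoneOn ⟨le_rfl, one_pos⟩ ht ht.1⟩
end

section
/- For every α ∈ (0,2) and every integer k ≥ 2, one has Γ(k+1+α/2) / (Γ(k+1)·(2k−α)) < k·(k+1)/(2−α). -/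
open Filter

/-- The Gamma function inequality used in the proof of Theorem 3.2. -/
theorem gamma_quotient_lt (α : ℝ) (hα : α ∈ Set.Ioo (0 : ℝ) 2) (k : ℕ) (hk : 2 ≤ k) :
    Real.Gamma ((k : ℝ) + 1 + α/2) / (Real.Gamma ((k : ℝ) + 1) * (2 * (k : ℝ) - α)) <
      (k : ℝ) * ((k : ℝ) + 1) / (2 - α) := by
  obtain ⟨h0, h2⟩ := hα
  have hk' : (2 : ℝ) ≤ k := by exact_mod_cast hk
  have hG : 0 < Real.Gamma ((k : ℝ) + 1) := Real.Gamma_pos_of_pos (by linarith)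
  have hlt : Real.Gamma ((k : ℝ) + 1 + α/2) < ((k : ℝ) + 1) * Real.Gamma ((k : ℝ) + 1) := by
    rw [← Real.Gamma_add_one (by linarith)]
    exact Real.Gamma_strictMonoOn_Ici (Set.mem_Ici.2 (by linarith)) (Set.mem_Ici.2 (by linarith))
      (by linarith)
  have hden : 0 < 2 * (k : ℝ) - α := by linarith
  calc Real.Gamma ((k : ℝ) + 1 + α/2) / (Real.Gamma ((k : ℝ) + 1) * (2 * (k : ℝ) - α))
      < ((k : ℝ) + 1) * Real.Gamma ((k : ℝ) + 1) /
          (Real.Gamma ((k : ℝ) + 1) * (2 * (k : ℝ) - α)) := by gcongr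
    _ = ((k : ℝ) + 1) / (2 * (k : ℝ) - α) := by field_simp
    _ ≤ (k : ℝ) * ((k : ℝ) + 1) / (2 - α) := by
        rw [div_le_div_iff₀ hden (by linarith)]
        have : 2 - α ≤ (k : ℝ) * (2 * (k : ℝ) - α) := by nlinarith
        nlinarith
end
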